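/- Let H be a subgraph of a simple graph G on {1,…,n}. Suppose E_H is finite-dimensional, let d₀ be the largest d with E_H^{d₀} ≠ 0, and let w₀ be an element spanning E_H^{d₀}. If w ∈ E_G satisfies x_{ij}·w = 0 for every edge {i,j} of H, then w = w₀·g for some g ∈ E_G. (Similarly, if w·x_{ij} = 0 for every edge {i,j} of H, then w = g′·w₀ for some g′ ∈ E_G.) -/

import Mathlib

open scoped TensorProduct

namespace FK

/-- Defining relations of the Fomin–Kirillov algebra `E n`, with generators indexed by
ordered pairs `(i, j)`; we also impose `x_{ii} = 0` and the antisymmetry `x_{ji} = -x_{ij}`,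
so that the generators of the algebra are the `x_{ij}` for `i < j`. -/
inductive Rel (n : ℕ) : FreeAlgebra ℚ (Fin n × Fin n) → FreeAlgebra ℚ (Fin n × Fin n) → Prop
  | diag (i : Fin n) : Rel n (FreeAlgebra.ι ℚ (i, i)) 0
  | antisymm (i j : Fin n) (hij : i ≠ j) :
      Rel n (FreeAlgebra.ι ℚ (j, i)) (-FreeAlgebra.ι ℚ (i, j))
  | square (i j : Fin n) (hij : i ≠ j) :
      Rel n (FreeAlgebra.ι ℚ (i, j) * FreeAlgebra.ι ℚ (i, j)) 0
  | comm (i j k l : Fin n) (h : List.Nodup [i, j, k, l]) :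
      Rel n (FreeAlgebra.ι ℚ (i, j) * FreeAlgebra.ι ℚ (k, l))
        (FreeAlgebra.ι ℚ (k, l) * FreeAlgebra.ι ℚ (i, j))
  | cyclic (i j k : Fin n) (h : List.Nodup [i, j, k]) :
      Rel n (FreeAlgebra.ι ℚ (i, j) * FreeAlgebra.ι ℚ (j, k)
        + FreeAlgebra.ι ℚ (j, k) * FreeAlgebra.ι ℚ (k, i)
        + FreeAlgebra.ι ℚ (k, i) * FreeAlgebra.ι ℚ (i, j)) 0

/-- The Fomin–Kirillov algebra `E n`. -/
abbrev E (n : ℕ) : Type := RingQuot (Rel n)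

/-- The generator `x_{ij}` of `E n`. -/
noncomputable def x (n : ℕ) (i j : Fin n) : E n :=
  RingQuot.mkAlgHom ℚ (Rel n) (FreeAlgebra.ι ℚ (i, j))

/-- The product of generators `x_{i₁j₁} ⋯ x_{i_d j_d}` given by a list of pairs. -/
noncomputable def word (n : ℕ) (l : List (Fin n × Fin n)) : E n :=
  (l.map fun p => x n p.1 p.2).prod

/-- The degree-`d` component of `E n`: the span of products of `d` generators. -/
def degSpan (n : ℕ) (d : ℕ) : Submodule ℚ (E n) :=
  Submodule.span ℚ {y | ∃ l : List (Fin n × Fin n),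
    (∀ p ∈ l, p.1 ≠ p.2) ∧ l.length = d ∧ y = word n l}

/-- The Fomin–Kirillov algebra of a graph `G`: the subalgebra of `E n` generated by the
`x_{ij}` with `{i,j}` an edge of `G`. -/
def EG (n : ℕ) (G : SimpleGraph (Fin n)) : Subalgebra ℚ (E n) :=
  Algebra.adjoin ℚ {y | ∃ i j : Fin n, G.Adj i j ∧ y = x n i j}

/-- The degree-`d` component `E_G^d = E_G ∩ E_n^d`. -/
def EGdeg (n : ℕ) (G : SimpleGraph (Fin n)) (d : ℕ) : Submodule ℚ (E n) :=
  (EG n G).toSubmodule ⊓ degSpan n d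

/-- The positive-degree part `E_G⁺` of `E_G`. -/
def EGplus (n : ℕ) (G : SimpleGraph (Fin n)) : Submodule ℚ (E n) :=
  ⨆ d : ℕ, ⨆ _ : 1 ≤ d, EGdeg n G d


theorem mul_le_mul_right_sub {n : ℕ} {A B C : Submodule ℚ (E n)} (h : B ≤ C) :
    A * B ≤ A * C := mul_le_mul' le_rfl h

theorem E_neg_mul {n : ℕ} (a b : E n) : -a * b = -(a * b) := by
  exact neg_mul a b

theorem E_mul_neg {n : ℕ} (a b : E n) : a * -b = -(a * b) := by
  exact mul_neg a b

theorem E_neg_smul {n : ℕ} (a : E n) : (-1 : ℚ) • a = -a := by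
  have h : (-1 : ℚ) • a + a = 0 := by
    nth_rewrite 2 [← one_smul ℚ a]
    rw [← add_smul]; simp
  exact eq_neg_of_add_eq_zero_left h

theorem x_diag (n : ℕ) (i : Fin n) : x n i i = 0 := by
  have := RingQuot.mkAlgHom_rel ℚ (Rel.diag i)
  simpa [x] using this

theorem x_antisymm (n : ℕ) (i j : Fin n) : x n j i = - x n i j := by
  by_cases hij : i = j
  · subst hij; simp [x_diag]
  · have := RingQuot.mkAlgHom_rel ℚ (Rel.antisymm i j hij)
    simpa [x] using this

theorem x_square (n : ℕ) (i j : Fin n) : x n i j * x n i j = 0 := by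
  by_cases hij : i = j
  · subst hij; simp [x_diag]
  · have := RingQuot.mkAlgHom_rel ℚ (Rel.square i j hij)
    simpa [x] using this

theorem x_comm (n : ℕ) (i j k l : Fin n) (h : List.Nodup [i, j, k, l]) :
    x n i j * x n k l = x n k l * x n i j := by
  have := RingQuot.mkAlgHom_rel ℚ (Rel.comm i j k l h)
  simpa [x] using this

theorem x_cyclic (n : ℕ) (i j k : Fin n) (h : List.Nodup [i, j, k]) :
    x n i j * x n j k + x n j k * x n k i + x n k i * x n i j = 0 := by
  have := RingQuot.mkAlgHom_rel ℚ (Rel.cyclic i j k h)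
  simpa [x] using this

/-- Universal property of `E n`. -/
theorem exists_lift (n : ℕ) {A : Type*} [Semiring A] [Algebra ℚ A] (y : Fin n → Fin n → A)
    (h1 : ∀ i, y i i = 0) (h2 : ∀ i j, i ≠ j → y j i = (-1 : ℚ) • y i j)
    (h3 : ∀ i j, i ≠ j → y i j * y i j = 0)
    (h4 : ∀ i j k l, List.Nodup [i, j, k, l] → y i j * y k l = y k l * y i j)
    (h5 : ∀ i j k, List.Nodup [i, j, k] →
      y i j * y j k + y j k * y k i + y k i * y i j = 0) :
    ∃ φ : E n →ₐ[ℚ] A, ∀ i j, φ (x n i j) = y i j := by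
  refine ⟨RingQuot.liftAlgHom ℚ ⟨FreeAlgebra.lift ℚ (fun p => y p.1 p.2), ?_⟩, ?_⟩
  · intro a b hab
    cases hab with
    | diag i => simp [h1]
    | antisymm i j hij =>
      have : -FreeAlgebra.ι ℚ (i, j) = (-1 : ℚ) • FreeAlgebra.ι ℚ (i, j) := by
        rw [neg_smul, one_smul]
      rw [this, map_smul]
      simpa using h2 i j hij
    | square i j hij => simpa using h3 i j hij
    | comm i j k l h => simpa using h4 i j k l h
    | cyclic i j k h => simpa using h5 i j k h
  · intro i j
    simp [x]

theorem exists_act (n : ℕ) (τ : Equiv.Perm (Fin n)) :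
    ∃ φ : E n →ₐ[ℚ] E n, ∀ i j, φ (x n i j) = x n (τ i) (τ j) := by
  apply exists_lift
  · intro i; exact x_diag n _
  · intro i j _; rw [E_neg_smul]; exact x_antisymm n _ _
  · intro i j _; exact x_square n _ _
  · intro i j k l h; apply x_comm; simpa using h
  · intro i j k h; apply x_cyclic; simpa using h

/-- The action of permutations on `E n`. -/
noncomputable def act (n : ℕ) (τ : Equiv.Perm (Fin n)) : E n →ₐ[ℚ] E n :=
  (exists_act n τ).choose

theorem act_x (n : ℕ) (τ : Equiv.Perm (Fin n)) (i j : Fin n) :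
    act n τ (x n i j) = x n (τ i) (τ j) := (exists_act n τ).choose_spec i j

theorem hom_ext (n : ℕ) {A : Type*} [Ring A] [Algebra ℚ A] (φ ψ : E n →ₐ[ℚ] A)
    (h : ∀ i j, φ (x n i j) = ψ (x n i j)) : φ = ψ := by
  apply RingQuot.ringQuot_ext'
  apply FreeAlgebra.hom_ext
  funext p
  exact h p.1 p.2

theorem act_act (n : ℕ) (τ τ' : Equiv.Perm (Fin n)) (a : E n) :
    act n τ (act n τ' a) = act n (τ * τ') a := by
  have : (act n τ).comp (act n τ') = act n (τ * τ') := by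
    apply hom_ext; intro i j; simp [act_x]
  exact DFunLike.congr_fun this a

theorem act_one (n : ℕ) (a : E n) : act n 1 a = a := by
  have : act n 1 = AlgHom.id ℚ (E n) := by
    apply hom_ext; intro i j; simp [act_x]
  exact DFunLike.congr_fun this a

/-- The operator by which `x_{ij}` acts on linear maps `Dual → E n`. -/
noncomputable def opr (n : ℕ) (i j : Fin n) :
    Module.End ℚ (Module.Dual ℚ (E n) →ₗ[ℚ] E n) where
  toFun F := (LinearMap.mulLeft ℚ (x n i j)).comp F +
    ((act n (Equiv.swap i j)).toLinearMap.comp F).comp (LinearMap.mulLeft ℚ (x n i j)).dualMap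
  map_add' F F' := by ext f; simp [mul_add]; abel
  map_smul' c F := by ext f; simp

theorem opr_apply (n : ℕ) (i j : Fin n) (F : Module.Dual ℚ (E n) →ₗ[ℚ] E n)
    (f : Module.Dual ℚ (E n)) :
    opr n i j F f = x n i j * F f +
      act n (Equiv.swap i j) (F (f ∘ₗ LinearMap.mulLeft ℚ (x n i j))) := rfl

theorem opr_mul_apply (n : ℕ) (i j k l : Fin n) (F : Module.Dual ℚ (E n) →ₗ[ℚ] E n)
    (f : Module.Dual ℚ (E n)) :
    (opr n i j * opr n k l) F f = x n i j * x n k l * F f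
      + x n i j * act n (Equiv.swap k l) (F (f ∘ₗ LinearMap.mulLeft ℚ (x n k l)))
      + x n (Equiv.swap i j k) (Equiv.swap i j l) *
          act n (Equiv.swap i j) (F (f ∘ₗ LinearMap.mulLeft ℚ (x n i j)))
      + act n (Equiv.swap i j * Equiv.swap k l)
          (F (f ∘ₗ LinearMap.mulLeft ℚ (x n i j * x n k l))) := by
  rw [Module.End.mul_apply, opr_apply, opr_apply, opr_apply, map_add, map_mul, act_x, act_act,
    LinearMap.comp_assoc, ← LinearMap.mulLeft_mul, mul_add, mul_assoc]
  abel

theorem exists_rho (n : ℕ) :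
    ∃ φ : E n →ₐ[ℚ] Module.End ℚ (Module.Dual ℚ (E n) →ₗ[ℚ] E n),
      ∀ i j, φ (x n i j) = opr n i j := by
  apply exists_lift
  · intro i
    refine LinearMap.ext fun F => LinearMap.ext fun f => ?_
    simp [opr_apply, x_diag]
  · intro i j hij
    refine LinearMap.ext fun F => LinearMap.ext fun f => ?_
    have : (LinearMap.mulLeft ℚ (-x n i j)) = - LinearMap.mulLeft ℚ (x n i j) := by
      ext; simp [E_neg_mul]
    rw [LinearMap.smul_apply, LinearMap.smul_apply, E_neg_smul]
    simp [opr_apply, x_antisymm n i j, Equiv.swap_comm j i, this, LinearMap.comp_neg, E_neg_mul]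
    abel
  · intro i j hij
    refine LinearMap.ext fun F => LinearMap.ext fun f => ?_
    rw [opr_mul_apply]
    simp [x_square, x_antisymm n i j, E_neg_mul]
  · intro i j k l h
    refine LinearMap.ext fun F => LinearMap.ext fun f => ?_
    rw [opr_mul_apply, opr_mul_apply]
    have hc := x_comm n i j k l h
    simp only [List.nodup_cons, List.mem_cons, not_or, List.not_mem_nil] at h
    obtain ⟨⟨h1, h2, h3, -⟩, ⟨h4, h5, -⟩, ⟨h6, -⟩, -⟩ := h
    have hs : Equiv.swap i j * Equiv.swap k l = Equiv.swap k l * Equiv.swap i j := by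
      apply Equiv.Perm.Disjoint.commute
      intro a
      by_cases ha : a = i
      · right; subst ha; exact Equiv.swap_apply_of_ne_of_ne h2 h3
      · by_cases ha' : a = j
        · right; subst ha'; exact Equiv.swap_apply_of_ne_of_ne h4 h5
        · left; exact Equiv.swap_apply_of_ne_of_ne ha ha'
    rw [hc, hs, Equiv.swap_apply_of_ne_of_ne (Ne.symm h2) (Ne.symm h4),
      Equiv.swap_apply_of_ne_of_ne (Ne.symm h3) (Ne.symm h5),
      Equiv.swap_apply_of_ne_of_ne h2 h3, Equiv.swap_apply_of_ne_of_ne h4 h5]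
    abel
  · intro i j k h
    refine LinearMap.ext fun F => LinearMap.ext fun f => ?_
    have hc := x_cyclic n i j k h
    simp only [LinearMap.add_apply, LinearMap.zero_apply]
    rw [opr_mul_apply, opr_mul_apply, opr_mul_apply]
    simp only [List.nodup_cons, List.mem_cons, not_or, List.not_mem_nil] at h
    obtain ⟨⟨h1, h2, -⟩, ⟨h3, -⟩, -⟩ := h
    have hs1 : Equiv.swap j k * Equiv.swap k i = Equiv.swap i j * Equiv.swap j k := by
      ext a; simp only [Equiv.Perm.mul_apply, Equiv.swap_apply_def]; grind
    have hs2 : Equiv.swap k i * Equiv.swap i j = Equiv.swap i j * Equiv.swap j k := by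
      ext a; simp only [Equiv.Perm.mul_apply, Equiv.swap_apply_def]; grind
    rw [hs1, hs2]
    have e1 : F (f ∘ₗ LinearMap.mulLeft ℚ (x n i j * x n j k))
        + F (f ∘ₗ LinearMap.mulLeft ℚ (x n j k * x n k i))
        + F (f ∘ₗ LinearMap.mulLeft ℚ (x n k i * x n i j)) = 0 := by
      rw [← map_add, ← map_add]
      convert map_zero F
      ext a
      simp only [LinearMap.add_apply, LinearMap.comp_apply, LinearMap.mulLeft_apply,
        LinearMap.zero_apply, ← map_add, ← add_mul, hc, zero_mul, map_zero]
    have e2 := congrArg (act n (Equiv.swap i j * Equiv.swap j k)) e1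
    simp only [map_add, map_zero] at e2
    have hc' := congrArg (· * F f) hc
    simp only [add_mul, zero_mul] at hc'
    rw [Equiv.swap_apply_right, Equiv.swap_apply_right, Equiv.swap_apply_right,
      Equiv.swap_apply_of_ne_of_ne (Ne.symm h2) (Ne.symm h3),
      Equiv.swap_apply_of_ne_of_ne h1 h2, Equiv.swap_apply_of_ne_of_ne h3 (Ne.symm h1),
      x_antisymm n k i, x_antisymm n i j, x_antisymm n j k]
    simp only [E_neg_mul]
    rw [← add_zero (0 : E n)]
    nth_rewrite 1 [← hc']
    rw [← e2]
    abel

/-- The map `a ↦ (f ↦ (1 ⊗ f) Δ(a))` given by the braided coproduct. -/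
noncomputable def T (n : ℕ) (f : Module.Dual ℚ (E n)) : E n →ₗ[ℚ] E n where
  toFun a := (exists_rho n).choose a ((LinearMap.toSpanSingleton ℚ (E n) 1).comp
    (LinearMap.applyₗ (1 : E n))) f
  map_add' a b := by simp
  map_smul' c a := by simp

theorem T_one (n : ℕ) (f : Module.Dual ℚ (E n)) : T n f 1 = f 1 • 1 := by
  simp [T]

theorem T_add (n : ℕ) (f g : Module.Dual ℚ (E n)) (a : E n) :
    T n (f + g) a = T n f a + T n g a := by simp [T]

theorem T_smul (n : ℕ) (c : ℚ) (f : Module.Dual ℚ (E n)) (a : E n) :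
    T n (c • f) a = c • T n f a := by simp [T]

theorem T_zero (n : ℕ) (a : E n) : T n 0 a = 0 := by simp [T]

theorem T_mul (n : ℕ) (f : Module.Dual ℚ (E n)) (i j : Fin n) (a : E n) :
    T n f (x n i j * a) = x n i j * T n f a +
      act n (Equiv.swap i j) (T n (f ∘ₗ LinearMap.mulLeft ℚ (x n i j)) a) := by
  simp only [T, LinearMap.coe_mk, AddHom.coe_mk, map_mul, Module.End.mul_apply]
  rw [(exists_rho n).choose_spec i j, opr_apply]

/-- all letters of the word are edges of `G` -/
def GW {n : ℕ} (G : SimpleGraph (Fin n)) (l : List (Fin n × Fin n)) : Prop :=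
  ∀ p ∈ l, G.Adj p.1 p.2

theorem word_nil (n : ℕ) : word n [] = 1 := by simp [word]

theorem word_cons (n : ℕ) (p : Fin n × Fin n) (l : List (Fin n × Fin n)) :
    word n (p :: l) = x n p.1 p.2 * word n l := by simp [word]

theorem word_append (n : ℕ) (l l' : List (Fin n × Fin n)) :
    word n (l ++ l') = word n l * word n l' := by simp [word]

theorem GW_cons {n : ℕ} {G : SimpleGraph (Fin n)} {p : Fin n × Fin n}
    {l : List (Fin n × Fin n)} : GW G (p :: l) ↔ G.Adj p.1 p.2 ∧ GW G l := by
  simp [GW]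

theorem x_mem_EG {n : ℕ} {G : SimpleGraph (Fin n)} {i j : Fin n} (h : G.Adj i j) :
    x n i j ∈ EG n G := Algebra.subset_adjoin ⟨i, j, h, rfl⟩

theorem word_mem_EG {n : ℕ} {G : SimpleGraph (Fin n)} {l : List (Fin n × Fin n)}
    (h : GW G l) : word n l ∈ EG n G := by
  induction l with
  | nil => rw [word_nil]; exact one_mem _
  | cons p l ih =>
    rw [GW_cons] at h
    rw [word_cons]
    exact mul_mem (x_mem_EG h.1) (ih h.2)

theorem EG_eq_span (n : ℕ) (G : SimpleGraph (Fin n)) :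
    (EG n G).toSubmodule = Submodule.span ℚ {y | ∃ l, GW G l ∧ y = word n l} := by
  apply le_antisymm
  · rw [EG, Algebra.adjoin_eq_span]
    apply Submodule.span_mono
    intro y hy
    induction hy using Submonoid.closure_induction with
    | mem y hy =>
      obtain ⟨i, j, h, rfl⟩ := hy
      exact ⟨[(i, j)], by simpa [GW] using h, by simp [word]⟩
    | one => exact ⟨[], by simp [GW], (word_nil n).symm⟩
    | mul a b _ _ ha hb =>
      obtain ⟨l, hl, rfl⟩ := ha
      obtain ⟨l', hl', rfl⟩ := hb
      refine ⟨l ++ l', ?_, (word_append n l l').symm⟩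
      intro p hp
      rcases List.mem_append.1 hp with h | h
      exacts [hl p h, hl' p h]
  · rw [Submodule.span_le]
    rintro y ⟨l, hl, rfl⟩
    exact word_mem_EG hl

theorem EG_induction {n : ℕ} {G : SimpleGraph (Fin n)} {P : (w : E n) → w ∈ EG n G → Prop}
    (hword : ∀ l (hl : GW G l), P (word n l) (word_mem_EG hl))
    (hadd : ∀ a b ha hb, P a ha → P b hb → P (a + b) (add_mem ha hb))
    (hsmul : ∀ (c : ℚ) a ha, P a ha → P (c • a) ((EG n G).smul_mem ha c))
    {w : E n} (hw : w ∈ EG n G) : P w hw := by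
  have hw' : w ∈ Submodule.span ℚ {y | ∃ l, GW G l ∧ y = word n l} := by
    rw [← EG_eq_span]; exact hw
  have key : ∃ h : w ∈ EG n G, P w h := by
    induction hw' using Submodule.span_induction with
    | mem y hy => obtain ⟨l, hl, rfl⟩ := hy; exact ⟨_, hword l hl⟩
    | zero =>
      have := hsmul 0 _ _ (hword [] (by simp [GW]))
      simp only [zero_smul] at this
      exact ⟨_, this⟩
    | add a b h1 h2 ha hb =>
      rw [← EG_eq_span] at h1 h2
      obtain ⟨h1', ha⟩ := ha h1
      obtain ⟨h2', hb⟩ := hb h2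
      exact ⟨_, hadd a b _ _ ha hb⟩
    | smul c a h1 ha =>
      rw [← EG_eq_span] at h1
      obtain ⟨h1', ha⟩ := ha h1
      exact ⟨_, hsmul c a _ ha⟩
  exact key.2

theorem EG_mono {n : ℕ} {G H : SimpleGraph (Fin n)} (h : H ≤ G) : EG n H ≤ EG n G := by
  apply Algebra.adjoin_mono
  rintro y ⟨i, j, hij, rfl⟩
  exact ⟨i, j, h hij, rfl⟩

/-- grading projections -/
theorem exists_proj (n d : ℕ) : ∃ π : E n →ₗ[ℚ] E n,
    ∀ l, π (word n l) = if l.length = d then word n l else 0 := by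
  obtain ⟨θ, hθ⟩ := exists_lift n (A := Polynomial (E n))
    (fun i j => Polynomial.monomial 1 (x n i j))
    (fun i => by simp [x_diag])
    (fun i j _ => by rw [Polynomial.smul_monomial, E_neg_smul, x_antisymm n i j])
    (fun i j _ => by simp [Polynomial.monomial_mul_monomial, x_square])
    (fun i j k l h => by simp [Polynomial.monomial_mul_monomial, x_comm n i j k l h])
    (fun i j k h => by
      simp only [Polynomial.monomial_mul_monomial, ← map_add, x_cyclic n i j k h, map_zero])
  have key : ∀ l, θ (word n l) = Polynomial.monomial l.length (word n l) := by
    intro l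
    induction l with
    | nil => simp [word_nil]
    | cons p l ih =>
      rw [word_cons, map_mul, ih, hθ, Polynomial.monomial_mul_monomial, List.length_cons,
        add_comm]
  refine ⟨{ toFun := fun a => (θ a).coeff d, map_add' := by simp, map_smul' := by simp }, ?_⟩
  intro l
  simp [key, Polynomial.coeff_monomial]

noncomputable def proj (n d : ℕ) : E n →ₗ[ℚ] E n := (exists_proj n d).choose

theorem proj_word (n d : ℕ) (l : List (Fin n × Fin n)) :
    proj n d (word n l) = if l.length = d then word n l else 0 :=
  (exists_proj n d).choose_spec l

theorem proj_degSpan {n d : ℕ} {a : E n} (h : a ∈ degSpan n d) : proj n d a = a := by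
  induction h using Submodule.span_induction with
  | mem y hy => obtain ⟨l, _, hl, rfl⟩ := hy; simp [proj_word, hl]
  | zero => simp
  | add a b _ _ ha hb => simp [ha, hb]
  | smul c a _ ha => simp [ha]

/-- T3 -/
theorem T_word {n : ℕ} {G : SimpleGraph (Fin n)} (l : List (Fin n × Fin n)) (hl : GW G l)
    (f : Module.Dual ℚ (E n)) (hf : ∀ l', GW G l' → l'.length < l.length → f (word n l') = 0) :
    T n f (word n l) = f (word n l) • 1 := by
  induction l generalizing f with
  | nil => rw [word_nil, T_one]
  | cons p l ih =>
    rw [GW_cons] at hl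
    rw [word_cons, T_mul, ih hl.2 f, hf l hl.2 (by simp), ih hl.2]
    · simp
    · intro l' hl' hlt
      have := hf (p :: l') (GW_cons.2 ⟨hl.1, hl'⟩) (by simpa using hlt)
      simpa [word_cons] using this
    · intro l' hl' hlt
      exact hf l' hl' (by simp; omega)

theorem T_vanish {n : ℕ} {G : SimpleGraph (Fin n)} (w : E n) (hw : w ∈ EG n G)
    (f : Module.Dual ℚ (E n)) (hf : ∀ a ∈ EG n G, f a = 0) : T n f w = 0 := by
  induction hw using EG_induction with
  | hword l hl =>
    rw [T_word l hl f (fun l' hl' _ => hf _ (word_mem_EG hl')), hf _ (word_mem_EG hl), zero_smul]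
  | hadd a b _ _ ha hb => simp [ha, hb]
  | hsmul c a _ ha => simp [ha]

/-- T2 -/
theorem T_linear {n : ℕ} {G H : SimpleGraph (Fin n)} (hHG : H ≤ G) (f : Module.Dual ℚ (E n))
    (hf : ∀ i j, H.Adj i j → ∀ a ∈ EG n G, f (x n i j * a) = 0)
    (w : E n) (hw : w ∈ EG n G) (b : E n) (hb : b ∈ EG n H) :
    T n f (b * w) = b * T n f w := by
  induction hb using EG_induction with
  | hword l hl =>
    induction l with
    | nil => simp [word_nil]
    | cons p l ih =>
      rw [GW_cons] at hl
      rw [word_cons, mul_assoc, T_mul, ih hl.2, T_vanish (G := G) (word n l * w), map_zero,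
        add_zero, mul_assoc]
      · exact mul_mem (EG_mono hHG (word_mem_EG hl.2)) hw
      · intro a ha; exact hf _ _ hl.1 a ha
  | hadd a b _ _ ha hb => simp [ha, hb, add_mul]
  | hsmul c a _ ha => simp [ha]

theorem mul_degSpan_x {n d : ℕ} {a : E n} (ha : a ∈ degSpan n d) {i j : Fin n} (hij : i ≠ j) :
    a * x n i j ∈ degSpan n (d + 1) ∧ x n i j * a ∈ degSpan n (d + 1) := by
  induction ha using Submodule.span_induction with
  | mem y hy =>
    obtain ⟨l, hl, hd, rfl⟩ := hy
    constructor
    · apply Submodule.subset_span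
      refine ⟨l ++ [(i, j)], ?_, by simp [hd], by simp [word]⟩
      intro p hp
      rcases List.mem_append.1 hp with h | h
      · exact hl p h
      · simp at h; subst h; exact hij
    · apply Submodule.subset_span
      refine ⟨(i, j) :: l, ?_, by simp [hd], by simp [word]⟩
      intro p hp
      rcases List.mem_cons.1 hp with h | h
      · subst h; exact hij
      · exact hl p h
  | zero => simp
  | add a b _ _ ha hb =>
    rw [add_mul, mul_add]; exact ⟨add_mem ha.1 hb.1, add_mem ha.2 hb.2⟩
  | smul c a _ ha =>
    rw [smul_mul_assoc, mul_smul_comm]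
    exact ⟨Submodule.smul_mem _ _ ha.1, Submodule.smul_mem _ _ ha.2⟩

theorem word_mem_degSpan {n : ℕ} {G : SimpleGraph (Fin n)} {l : List (Fin n × Fin n)}
    (hl : GW G l) : word n l ∈ degSpan n l.length :=
  Submodule.subset_span ⟨l, fun p hp => (hl p hp).ne, rfl, rfl⟩

section top
variable {n : ℕ} {H : SimpleGraph (Fin n)} {d₀ : ℕ} {w₀ : E n}

theorem top_kill (hmax : ∀ d : ℕ, d₀ < d → EGdeg n H d = ⊥)
    (hw₀ : EGdeg n H d₀ = Submodule.span ℚ {w₀}) (i j : Fin n) (h : H.Adj i j) :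
    w₀ * x n i j = 0 ∧ x n i j * w₀ = 0 := by
  have hm : w₀ ∈ EGdeg n H d₀ := by rw [hw₀]; exact Submodule.mem_span_singleton_self _
  have hk := mul_degSpan_x hm.2 h.ne
  have hb := hmax (d₀ + 1) (by omega)
  constructor
  · have : w₀ * x n i j ∈ EGdeg n H (d₀ + 1) := ⟨(EG n H).mul_mem hm.1 (x_mem_EG h), hk.1⟩
    rw [hb] at this; simpa using this
  · have : x n i j * w₀ ∈ EGdeg n H (d₀ + 1) := ⟨(EG n H).mul_mem (x_mem_EG h) hm.1, hk.2⟩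
    rw [hb] at this; simpa using this

/-- the socle of `E_H` is spanned by `w₀` -/
theorem socle (h₀ : EGdeg n H d₀ ≠ ⊥) (hmax : ∀ d : ℕ, d₀ < d → EGdeg n H d = ⊥)
    (hw₀ : EGdeg n H d₀ = Submodule.span ℚ {w₀}) (h : E n) (hh : h ∈ EG n H)
    (hk : ∀ i j, H.Adj i j → x n i j * h = 0) : ∃ c : ℚ, h = c • w₀ := by
  have hm : w₀ ∈ EGdeg n H d₀ := by rw [hw₀]; exact Submodule.mem_span_singleton_self _
  have hne : w₀ ≠ 0 := by
    rintro rfl; apply h₀; rw [hw₀]; simp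
  obtain ⟨μ, hμ⟩ : ∃ μ : Module.Dual ℚ (E n), μ w₀ = 1 := by
    obtain ⟨μ, hμ⟩ : ∃ μ : Module.Dual ℚ (E n), μ w₀ ≠ 0 := by
      by_contra! hcon
      exact hne ((Module.forall_dual_apply_eq_zero_iff ℚ w₀).1 hcon)
    exact ⟨(μ w₀)⁻¹ • μ, by simp [hμ]⟩
  set lam : Module.Dual ℚ (E n) := μ ∘ₗ proj n d₀ with hlam
  have hlw : lam w₀ = 1 := by simp [hlam, proj_degSpan hm.2, hμ]
  have hlword : ∀ l : List (Fin n × Fin n), l.length ≠ d₀ → lam (word n l) = 0 := by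
    intro l hl; simp [hlam, proj_word, hl]
  have hT : ∀ a ∈ EG n H, T n lam a = lam a • 1 := by
    intro a ha
    induction ha using EG_induction with
    | hword l hl =>
      by_cases hld : l.length ≤ d₀
      · exact T_word l hl lam (fun l' _ hlt => hlword l' (by omega))
      · have : word n l ∈ EGdeg n H l.length := ⟨word_mem_EG hl, word_mem_degSpan hl⟩
        rw [hmax _ (by omega)] at this
        rw [(Submodule.mem_bot ℚ).1 this]; simp
    | hadd a b _ _ ha hb => simp [ha, hb, add_smul]
    | hsmul c a _ ha => simp [ha, mul_smul]
  refine ⟨lam h, ?_⟩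
  -- `r` is the difference
  set r := h - lam h • w₀ with hr
  have hrm : r ∈ EG n H := sub_mem hh ((EG n H).toSubmodule.smul_mem _ hm.1)
  have hrk : ∀ i j, H.Adj i j → x n i j * r = 0 := by
    intro i j hij
    rw [hr, mul_sub, hk i j hij, mul_smul_comm, (top_kill hmax hw₀ i j hij).2]; simp
  have hlr : lam r = 0 := by simp [hr, hlw]
  have hz : ∀ l, GW H l → T n (lam ∘ₗ LinearMap.mulLeft ℚ (word n l)) r = 0 := by
    intro l hl
    induction l using List.reverseRecOn with
    | nil =>
      have : lam ∘ₗ LinearMap.mulLeft ℚ (word n []) = lam := by ext; simp [word_nil]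
      rw [this, hT r hrm, hlr, zero_smul]
    | append_singleton l p ih =>
      have hl1 : GW H l := fun q hq => hl q (by simp [hq])
      have hp : H.Adj p.1 p.2 := hl p (by simp)
      have h1 := T_mul n (lam ∘ₗ LinearMap.mulLeft ℚ (word n l)) p.1 p.2 r
      rw [hrk _ _ hp, ih hl1, mul_zero, zero_add, map_zero] at h1
      have h2 := congrArg (act n (Equiv.swap p.1 p.2)) h1
      rw [act_act, Equiv.swap_mul_self, act_one, map_zero, LinearMap.comp_assoc,
        ← LinearMap.mulLeft_mul] at h2
      rw [word_append]
      have : word n [p] = x n p.1 p.2 := by simp [word]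
      rw [this]; exact h2.symm
  have hz' : ∀ b ∈ EG n H, T n (lam ∘ₗ LinearMap.mulLeft ℚ b) r = 0 := by
    intro b hb
    induction hb using EG_induction with
    | hword l hl => exact hz l hl
    | hadd a b _ _ ha hb =>
      have : lam ∘ₗ LinearMap.mulLeft ℚ (a + b)
        = lam ∘ₗ LinearMap.mulLeft ℚ a + lam ∘ₗ LinearMap.mulLeft ℚ b := by
        ext; simp [add_mul]
      rw [this, T_add, ha, hb, add_zero]
    | hsmul c a _ ha =>
      have : lam ∘ₗ LinearMap.mulLeft ℚ (c • a) = c • (lam ∘ₗ LinearMap.mulLeft ℚ a) := by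
        ext; simp
      rw [this, T_smul, ha, smul_zero]
  have hid : ∀ a ∈ EG n H, T n (lam ∘ₗ LinearMap.mulLeft ℚ w₀) a = a := by
    intro a ha
    have := T_linear (le_refl H) (lam ∘ₗ LinearMap.mulLeft ℚ w₀) (by
      intro i j hij a _
      simp [← mul_assoc, (top_kill hmax hw₀ i j hij).1]) 1 (one_mem _) a ha
    rw [T_one] at this
    simpa [hlw] using this
  have hr0 : r = 0 := by rw [← hid r hrm]; exact hz' w₀ hm.1
  rw [hr] at hr0
  exact sub_eq_zero.1 hr0

end top

/-- span of the words of length `< D` in edges of `G` -/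
def low (n : ℕ) (G : SimpleGraph (Fin n)) (D : ℕ) : Submodule ℚ (E n) :=
  Submodule.span ℚ {y | ∃ l, GW G l ∧ l.length < D ∧ y = word n l}

theorem low_le (n : ℕ) (G : SimpleGraph (Fin n)) (D : ℕ) :
    low n G D ≤ (EG n G).toSubmodule := by
  rw [low, Submodule.span_le]
  rintro y ⟨l, hl, _, rfl⟩
  exact word_mem_EG hl

theorem low_mono {n : ℕ} {G : SimpleGraph (Fin n)} {D D' : ℕ} (h : D ≤ D') :
    low n G D ≤ low n G D' := by
  apply Submodule.span_mono
  rintro y ⟨l, hl, hd, rfl⟩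
  exact ⟨l, hl, by omega, rfl⟩

theorem EG_low {n : ℕ} {G : SimpleGraph (Fin n)} {w : E n} (hw : w ∈ EG n G) :
    ∃ D, w ∈ low n G D := by
  induction hw using EG_induction with
  | hword l hl => exact ⟨l.length + 1, Submodule.subset_span ⟨l, hl, by simp, rfl⟩⟩
  | hadd a b _ _ ha hb =>
    obtain ⟨D, hD⟩ := ha
    obtain ⟨D', hD'⟩ := hb
    exact ⟨max D D', add_mem (low_mono (le_max_left _ _) hD) (low_mono (le_max_right _ _) hD')⟩
  | hsmul c a _ ha =>
    obtain ⟨D, hD⟩ := ha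
    exact ⟨D, Submodule.smul_mem _ _ hD⟩

/-- projecting `x_e m` to degree `D` -/
theorem proj_x_mul {n : ℕ} {G H : SimpleGraph (Fin n)} (D : ℕ) {i j : Fin n}
    (hij : H.Adj i j) {a : E n} (ha : a ∈ EG n G) :
    proj n D (x n i j * a) ∈ (EG n H).toSubmodule * low n G D := by
  induction ha using EG_induction with
  | hword l hl =>
    have : x n i j * word n l = word n ((i, j) :: l) := by rw [word_cons]
    rw [this, proj_word]
    split_ifs with h
    · rw [word_cons]
      apply Submodule.mul_mem_mul (x_mem_EG hij)
      exact Submodule.subset_span ⟨l, hl, by simp at h; omega, rfl⟩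
    · exact zero_mem _
  | hadd a b _ _ ha hb => rw [mul_add, map_add]; exact add_mem ha hb
  | hsmul c a _ ha => rw [mul_smul_comm, map_smul]; exact Submodule.smul_mem _ _ ha

section main
variable {n : ℕ} {G H : SimpleGraph (Fin n)} {d₀ : ℕ} {w₀ : E n}

theorem inner (hHG : H ≤ G)
    (h₀ : EGdeg n H d₀ ≠ ⊥) (hmax : ∀ d : ℕ, d₀ < d → EGdeg n H d = ⊥)
    (hw₀ : EGdeg n H d₀ = Submodule.span ℚ {w₀}) (D : ℕ)
    (ih : ∀ w ∈ (EG n H).toSubmodule * low n G D,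
      (∀ i j : Fin n, H.Adj i j → x n i j * w = 0) → ∃ g ∈ EG n G, w = w₀ * g)
    (L : List (List (Fin n × Fin n))) (hL : ∀ l ∈ L, GW G l ∧ l.length = D) :
    ∀ w ∈ (EG n H).toSubmodule * (low n G D ⊔ Submodule.span ℚ {y | ∃ l ∈ L, y = word n l}),
      (∀ i j : Fin n, H.Adj i j → x n i j * w = 0) → ∃ g ∈ EG n G, w = w₀ * g := by
  induction L with
  | nil => simpa using ih
  | cons l L ihL =>
    replace ihL := ihL (fun l' h => hL l' (by simp [h]))
    obtain ⟨hl, hlD⟩ := hL l (by simp)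
    set S := Submodule.span ℚ {y | ∃ l ∈ L, y = word n l} with hS
    have hSG : S ≤ (EG n G).toSubmodule := by
      rw [hS, Submodule.span_le]; rintro y ⟨l', hl', rfl⟩
      exact word_mem_EG (hL l' (by simp [hl'])).1
    have hSe : Submodule.span ℚ {y | ∃ l' ∈ l :: L, y = word n l'}
        = S ⊔ Submodule.span ℚ {word n l} := by
      rw [hS, ← Submodule.span_union]
      congr 1
      ext y
      simp
    rw [hSe, ← sup_assoc, Submodule.mul_sup]
    set V := (EG n H).toSubmodule * (low n G D ⊔ S) with hV
    set P := Submodule.span ℚ {y | ∃ i j, H.Adj i j ∧ ∃ a ∈ EG n G, y = x n i j * a} with hP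
    have hprojlow : ∀ a ∈ low n G D, proj n D a = 0 := by
      intro a ha
      induction ha using Submodule.span_induction with
      | mem y hy => obtain ⟨l', _, hd, rfl⟩ := hy; rw [proj_word, if_neg (by omega)]
      | zero => simp
      | add a b _ _ ha hb => simp [ha, hb]
      | smul c a _ ha => simp [ha]
    have hprojS : ∀ a ∈ S, proj n D a = a := by
      intro a ha
      induction ha using Submodule.span_induction with
      | mem y hy =>
        obtain ⟨l', hd, rfl⟩ := hy
        rw [proj_word, if_pos (hL l' (by simp [hd])).2]
      | zero => simp
      | add a b _ _ ha hb => simp [ha, hb]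
      | smul c a _ ha => simp [ha]
    have hprojP : ∀ a ∈ P, proj n D a ∈ (EG n H).toSubmodule * low n G D := by
      intro a ha
      induction ha using Submodule.span_induction with
      | mem y hy => obtain ⟨i, j, hij, a, ha, rfl⟩ := hy; exact proj_x_mul D hij ha
      | zero => simp
      | add a b _ _ ha hb => rw [map_add]; exact add_mem ha hb
      | smul c a _ ha => rw [map_smul]; exact Submodule.smul_mem _ _ ha
    intro w hw hwk
    by_cases hc : word n l ∈ (low n G D ⊔ S) ⊔ P
    · -- the new word is redundant
      apply ihL w _ hwk
      have hcV : word n l ∈ V := by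
        obtain ⟨a, ha, p, hp, hap⟩ := Submodule.mem_sup.1 hc
        obtain ⟨b, hb, s, hs, rfl⟩ := Submodule.mem_sup.1 ha
        have := congrArg (proj n D) hap
        rw [map_add, map_add, hprojlow b hb, hprojS s hs, proj_word, if_pos hlD, zero_add] at this
        rw [← this]
        apply add_mem
        · rw [← one_mul s]
          exact Submodule.mul_mem_mul (one_mem (EG n H)) (Submodule.mem_sup_right hs)
        · exact (mul_le_mul_right_sub le_sup_left) (hprojP p hp)
      have hle : (EG n H).toSubmodule * Submodule.span ℚ {word n l} ≤ V := by
        calc (EG n H).toSubmodule * Submodule.span ℚ {word n l}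
            ≤ (EG n H).toSubmodule * V := by
              refine mul_le_mul' le_rfl ?_
              rw [Submodule.span_singleton_le_iff_mem]; exact hcV
          _ = V := by rw [hV, ← mul_assoc, (EG n H).isIdempotentElem_toSubmodule.eq]
      exact (sup_le le_rfl hle) hw
    · obtain ⟨f', hf'c, hf'⟩ := Submodule.exists_dual_map_eq_bot_of_notMem hc inferInstance
      obtain ⟨f, hfc, hf⟩ : ∃ f : Module.Dual ℚ (E n), f (word n l) = 1 ∧
          ∀ a ∈ (low n G D ⊔ S) ⊔ P, f a = 0 := by
        refine ⟨(f' (word n l))⁻¹ • f', by simp [hf'c], ?_⟩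
        intro a ha
        have : f' a ∈ Submodule.map f' ((low n G D ⊔ S) ⊔ P) := Submodule.mem_map_of_mem ha
        rw [hf'] at this
        simp [(Submodule.mem_bot ℚ).1 this]
      have hflow : ∀ l', GW G l' → l'.length < D → f (word n l') = 0 := by
        intro l' hl' hd
        exact hf _ (Submodule.mem_sup_left (Submodule.mem_sup_left
          (Submodule.subset_span ⟨l', hl', hd, rfl⟩)))
      have hTlin : ∀ a ∈ EG n G, ∀ b ∈ EG n H, T n f (b * a) = b * T n f a := by
        intro a ha b hb
        refine T_linear hHG f ?_ a ha b hb
        intro i j hij a ha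
        exact hf _ (Submodule.mem_sup_right (Submodule.subset_span ⟨i, j, hij, a, ha, rfl⟩))
      have hTlow : ∀ a ∈ low n G D ⊔ S, T n f a = 0 := by
        have : low n G D ⊔ S ≤ LinearMap.ker (T n f) := by
          apply sup_le
          · rw [low, Submodule.span_le]
            rintro y ⟨l', hl', hd, rfl⟩
            change T n f _ = 0
            rw [T_word l' hl' f (fun l'' h'' hd'' => hflow l'' h'' (by omega)), hflow l' hl' hd,
              zero_smul]
          · rw [hS, Submodule.span_le]
            rintro y ⟨l', hl', rfl⟩
            change T n f _ = 0
            obtain ⟨h1, h2⟩ := hL l' (by simp [hl'])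
            rw [T_word l' h1 f (fun l'' h'' hd'' => hflow l'' h'' (by omega)),
              hf _ (Submodule.mem_sup_left (Submodule.mem_sup_right
                (Submodule.subset_span ⟨l', hl', rfl⟩))), zero_smul]
        intro a ha; exact this ha
      have hTV : ∀ v ∈ V, T n f v = 0 := by
        have : V ≤ LinearMap.ker (T n f) := by
          rw [hV, Submodule.mul_le]
          intro b hb a ha
          change T n f _ = 0
          rw [hTlin a ((sup_le (low_le n G D) hSG) ha) b hb, hTlow a ha, mul_zero]
        intro a ha; exact this ha
      have hTc : T n f (word n l) = 1 := by
        rw [T_word l hl f (fun l'' h'' hd'' => hflow l'' h'' (by omega)), hfc, one_smul]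
      obtain ⟨v, hv, u, hu, rfl⟩ := Submodule.mem_sup.1 hw
      obtain ⟨h, hh, rfl⟩ := Submodule.mem_mul_span_singleton.1 hu
      have hVG : V ≤ (EG n G).toSubmodule := by
        rw [hV, Submodule.mul_le]
        intro b hb a ha
        exact (EG n G).mul_mem (EG_mono hHG hb) ((sup_le (low_le n G D) hSG) ha)
      have hTw : T n f (v + h * word n l) = h := by
        rw [map_add, hTV v hv, hTlin _ (word_mem_EG hl) h hh, hTc, zero_add, mul_one]
      have hhk : ∀ i j, H.Adj i j → x n i j * h = 0 := by
        intro i j hij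
        have := hTlin (v + h * word n l)
          (add_mem (hVG hv) (mul_mem (EG_mono hHG hh) (word_mem_EG hl))) _ (x_mem_EG hij)
        rw [hwk i j hij, hTw, map_zero] at this
        exact this.symm
      obtain ⟨c, rfl⟩ := socle h₀ hmax hw₀ h hh hhk
      have hvk : ∀ i j, H.Adj i j → x n i j * v = 0 := by
        intro i j hij
        have := hwk i j hij
        rw [mul_add, ← mul_assoc, mul_smul_comm, (top_kill hmax hw₀ i j hij).2] at this
        simpa using this
      obtain ⟨g, hg, rfl⟩ := ihL v hv hvk
      refine ⟨g + c • word n l, add_mem hg ((EG n G).toSubmodule.smul_mem _ (word_mem_EG hl)), ?_⟩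
      rw [mul_add, mul_smul_comm, smul_mul_assoc]

theorem outer (hHG : H ≤ G)
    (h₀ : EGdeg n H d₀ ≠ ⊥) (hmax : ∀ d : ℕ, d₀ < d → EGdeg n H d = ⊥)
    (hw₀ : EGdeg n H d₀ = Submodule.span ℚ {w₀}) (D : ℕ) :
    ∀ w ∈ (EG n H).toSubmodule * low n G D,
      (∀ i j : Fin n, H.Adj i j → x n i j * w = 0) → ∃ g ∈ EG n G, w = w₀ * g := by
  induction D with
  | zero =>
    intro w hw _
    have : low n G 0 = ⊥ := by simp [low]
    rw [this, Submodule.mul_bot] at hw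
    exact ⟨0, zero_mem _, by simpa using hw⟩
  | succ D ih =>
    have hfin : {l : List (Fin n × Fin n) | l.length = D}.Finite := List.finite_length_eq _ D
    have hfin' : {l : List (Fin n × Fin n) | GW G l ∧ l.length = D}.Finite :=
      hfin.subset fun l hl => hl.2
    have := inner hHG h₀ hmax hw₀ D ih hfin'.toFinset.toList (by simp)
    intro w hw hk
    refine this w ?_ hk
    refine (mul_le_mul_right_sub ?_) hw
    rw [low, Submodule.span_le]
    rintro y ⟨l, hl, hd, rfl⟩
    by_cases hlD : l.length < D
    · exact Submodule.mem_sup_left (Submodule.subset_span ⟨l, hl, hlD, rfl⟩)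
    · exact Submodule.mem_sup_right (Submodule.subset_span ⟨l, by simp [hl]; omega, rfl⟩)

theorem left_version (hHG : H ≤ G)
    (h₀ : EGdeg n H d₀ ≠ ⊥) (hmax : ∀ d : ℕ, d₀ < d → EGdeg n H d = ⊥)
    (hw₀ : EGdeg n H d₀ = Submodule.span ℚ {w₀}) (w : E n) (hw : w ∈ EG n G)
    (hk : ∀ i j : Fin n, H.Adj i j → x n i j * w = 0) : ∃ g ∈ EG n G, w = w₀ * g := by
  obtain ⟨D, hD⟩ := EG_low hw
  refine outer hHG h₀ hmax hw₀ D w ?_ hk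
  rw [← one_mul w]
  exact Submodule.mul_mem_mul (one_mem (EG n H)) hD

end main

/-- the reversal anti-automorphism -/
theorem exists_rev (n : ℕ) : ∃ ρ : E n →ₗ[ℚ] E n, (∀ a b, ρ (a * b) = ρ b * ρ a) ∧
    ρ 1 = 1 ∧ ∀ i j, ρ (x n i j) = x n i j := by
  obtain ⟨θ, hθ⟩ := exists_lift n (A := (E n)ᵐᵒᵖ)
    (fun i j => MulOpposite.op (x n i j))
    (fun i => by simp [x_diag])
    (fun i j _ => by rw [← MulOpposite.op_smul, E_neg_smul, x_antisymm n i j])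
    (fun i j _ => by simp [← MulOpposite.op_mul, x_square])
    (fun i j k l h => by simp [← MulOpposite.op_mul, x_comm n i j k l h])
    (fun i j k h => by
      have := x_cyclic n k j i (by simp at h ⊢; grind)
      rw [x_antisymm n j k, x_antisymm n i j, x_antisymm n k i] at this
      simp only [E_neg_mul, E_mul_neg, neg_neg] at this
      rw [← MulOpposite.op_mul, ← MulOpposite.op_mul, ← MulOpposite.op_mul, ← MulOpposite.op_add,
        ← MulOpposite.op_add, MulOpposite.op_eq_zero_iff, ← this]
      abel)
  refine ⟨{ toFun := fun a => (θ a).unop, map_add' := by simp, map_smul' := by simp }, ?_, ?_, ?_⟩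
  · intro a b; simp
  · simp
  · intro i j; simp [hθ]

/-- let `H ⊆ G` with `E_H` finite-dimensional, top degree `d₀`, and `w₀`
spanning `E_H^{d₀}`.  If `w ∈ E_G` is killed on the left by every generator `x_{ij}` with
`{i,j}` an edge of `H`, then `w = w₀·g` for some `g ∈ E_G`; similarly on the right. -/
theorem stmt16 (n : ℕ) (hn : 1 ≤ n) (G H : SimpleGraph (Fin n)) (hHG : H ≤ G)
    (hfd : FiniteDimensional ℚ ↥(EG n H)) (d₀ : ℕ)
    (h₀ : EGdeg n H d₀ ≠ ⊥) (hmax : ∀ d : ℕ, d₀ < d → EGdeg n H d = ⊥)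
    (w₀ : E n) (hw₀ : EGdeg n H d₀ = Submodule.span ℚ {w₀})
    (w : E n) (hw : w ∈ EG n G) :
    ((∀ i j : Fin n, H.Adj i j → x n i j * w = 0) →
      ∃ g ∈ EG n G, w = w₀ * g) ∧
    ((∀ i j : Fin n, H.Adj i j → w * x n i j = 0) →
      ∃ g' ∈ EG n G, w = g' * w₀) := by
  refine ⟨left_version hHG h₀ hmax hw₀ w hw, fun hk => ?_⟩
  obtain ⟨ρ, hmul, hone, hx⟩ := exists_rev n
  have hword : ∀ l, ρ (word n l) = word n l.reverse := by
    intro l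
    induction l with
    | nil => simp [word_nil, hone]
    | cons p l ih =>
      rw [word_cons, hmul, hx, ih, List.reverse_cons, word_append]
      simp [word]
  have hinv : ∀ a, ρ (ρ a) = a := by
    intro a
    obtain ⟨θ, hθ⟩ : ∃ θ : E n →ₐ[ℚ] E n, ∀ a, θ a = ρ (ρ a) :=
      ⟨AlgHom.ofLinearMap (ρ ∘ₗ ρ) (by simp [hone]) (by simp [hmul]), fun a => rfl⟩
    have : θ = AlgHom.id ℚ (E n) := by
      apply hom_ext; intro i j; simp [hθ, hx]
    rw [← hθ, this]; rfl
  have hEG : ∀ (K : SimpleGraph (Fin n)) a, a ∈ EG n K → ρ a ∈ EG n K := by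
    intro K a ha
    induction ha using EG_induction with
    | hword l hl =>
      rw [hword]
      exact word_mem_EG (fun p hp => hl p (by simpa using hp))
    | hadd a b _ _ ha hb => rw [map_add]; exact add_mem ha hb
    | hsmul c a _ ha => rw [map_smul]; exact (EG n K).toSubmodule.smul_mem _ ha
  have hdeg : ∀ d a, a ∈ degSpan n d → ρ a ∈ degSpan n d := by
    intro d a ha
    induction ha using Submodule.span_induction with
    | mem y hy =>
      obtain ⟨l, hl, hd, rfl⟩ := hy
      rw [hword]
      exact Submodule.subset_span ⟨l.reverse, fun p hp => hl p (by simpa using hp), by simpa, rfl⟩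
    | zero => simp
    | add a b _ _ ha hb => rw [map_add]; exact add_mem ha hb
    | smul c a _ ha => rw [map_smul]; exact Submodule.smul_mem _ _ ha
  have hED : ∀ a, a ∈ EGdeg n H d₀ → ρ a ∈ EGdeg n H d₀ :=
    fun a ha => ⟨hEG H a ha.1, hdeg d₀ a ha.2⟩
  have hw₀' : EGdeg n H d₀ = Submodule.span ℚ {ρ w₀} := by
    apply le_antisymm
    · intro a ha
      have h1 := hED a ha
      rw [hw₀] at h1
      obtain ⟨c, hc⟩ := Submodule.mem_span_singleton.1 h1
      rw [← hinv a, ← hc, map_smul]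
      exact Submodule.smul_mem _ _ (Submodule.mem_span_singleton_self _)
    · rw [Submodule.span_singleton_le_iff_mem]
      apply hED
      rw [hw₀]; exact Submodule.mem_span_singleton_self _
  obtain ⟨g, hg, hgw⟩ := left_version hHG h₀ hmax hw₀' (ρ w) (hEG G w hw) (by
    intro i j hij
    rw [← hx i j, ← hmul, hk i j hij, map_zero])
  refine ⟨ρ g, hEG G g hg, ?_⟩
  rw [← hinv w, hgw, hmul, hinv]

end FK
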